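/- Let α > 1, p = 1/(α−1), σ = (π/4)·min{1,1/p}, and L > 0. If λ > (2L^α/sin σ)^p / p, then the function f_λ (equal to 0 on (−∞,0] and exp(−λ√2 x^{−p}) on (0,∞)) satisfies ∑_{k∈ℕ} (L^{kα}/(k!)^α) · sup_{x∈ℝ} |f_λ^{(k)}(x)| < ∞, i.e. f_λ is a Gevrey-α function. -/

import Mathlib

open Real

/-- The one-sided Gevrey bump factor: f_λ(x) = 0 for x ≤ 0 and
f_λ(x) = exp(−λ√2 · x^{−p}) for x > 0. -/
noncomputable def flam (lam p : ℝ) (x : ℝ) : ℝ :=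
  if x ≤ 0 then 0 else Real.exp (-(lam * Real.sqrt 2 * x ^ (-p)))

/-- The holomorphic extension of `flam` from the positive half-line to the right half-plane. -/
noncomputable def flamComplex (lam p : ℝ) (z : ℂ) : ℂ :=
  Complex.exp (-(((lam * Real.sqrt 2 : ℝ) : ℂ) * z ^ (((-p : ℝ)) : ℂ)))

lemma differentiableAt_flamComplex (lam p : ℝ) {z : ℂ} (hz : 0 < z.re) :
    DifferentiableAt ℂ (flamComplex lam p) z := by
  have hz' : z ∈ Complex.slitPlane := Or.inl hz
  have h : DifferentiableAt ℂ (fun z : ℂ => z ^ (((-p : ℝ)) : ℂ)) z :=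
    differentiableAt_id.cpow_const hz'
  exact ((h.const_mul _).neg).cexp

lemma differentiableAt_iteratedDeriv_flamComplex (lam p : ℝ) (k : ℕ) {z : ℂ} (hz : 0 < z.re) :
    DifferentiableAt ℂ (iteratedDeriv k (flamComplex lam p)) z := by
  have hopen : IsOpen {w : ℂ | 0 < w.re} := isOpen_lt continuous_const Complex.continuous_re
  have han : AnalyticAt ℂ (flamComplex lam p) z :=
    (DifferentiableOn.analyticAt (s := {w : ℂ | 0 < w.re})
      (fun w hw => (differentiableAt_flamComplex lam p hw).differentiableWithinAt)
      (hopen.mem_nhds hz))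
  rw [iteratedDeriv_eq_iterate]
  exact (han.iterated_deriv k).differentiableAt

lemma flam_eq_re_flamComplex (lam p : ℝ) {x : ℝ} (hx : 0 < x) :
    flam lam p x = (flamComplex lam p x).re := by
  rw [flam, if_neg hx.not_ge, flamComplex, ← Complex.ofReal_cpow hx.le, ← Complex.ofReal_mul,
    ← Complex.ofReal_neg, ← Complex.ofReal_exp, Complex.ofReal_re]

lemma iteratedDeriv_flam_of_pos (lam p : ℝ) (k : ℕ) {x : ℝ} (hx : 0 < x) :
    iteratedDeriv k (flam lam p) x = (iteratedDeriv k (flamComplex lam p) x).re := by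
  induction k generalizing x with
  | zero => simpa using flam_eq_re_flamComplex lam p hx
  | succ k ih =>
    rw [iteratedDeriv_succ, iteratedDeriv_succ]
    have hev : iteratedDeriv k (flam lam p) =ᶠ[nhds x]
        fun y : ℝ => (iteratedDeriv k (flamComplex lam p) y).re := by
      filter_upwards [lt_mem_nhds hx] with y hy using ih hy
    rw [hev.deriv_eq]
    exact (differentiableAt_iteratedDeriv_flamComplex lam p k
      (by simpa using hx)).hasDerivAt.real_of_complex.deriv

/-- At `0` no smoothness is needed: a derivative which exists agrees with the left derivative. -/
lemma iteratedDeriv_flam_of_nonpos (lam p : ℝ) (k : ℕ) {x : ℝ} (hx : x ≤ 0) :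
    iteratedDeriv k (flam lam p) x = 0 := by
  induction k generalizing x with
  | zero => simp [flam, hx]
  | succ k ih =>
    rw [iteratedDeriv_succ]
    by_cases hd : DifferentiableAt ℝ (iteratedDeriv k (flam lam p)) x
    · have hu : UniqueDiffWithinAt ℝ (Set.Iic x) x := uniqueDiffOn_Iic x x Set.self_mem_Iic
      have h0 : HasDerivWithinAt (iteratedDeriv k (flam lam p)) 0 (Set.Iic x) x :=
        (hasDerivWithinAt_const x (Set.Iic x) (0 : ℝ)).congr
          (fun y hy => ih (le_trans hy hx)) (ih hx)
      exact hu.eq_deriv _ hd.hasDerivAt.hasDerivWithinAt h0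
    · exact deriv_zero_of_not_differentiableAt hd

lemma re_pos_of_norm_sub_le {x s : ℝ} (hx : 0 < x) (hs : s < 1) {z : ℂ}
    (hz : ‖z - x‖ ≤ x * s) : 0 < z.re := by
  have h := (Complex.abs_re_le_norm (z - x)).trans hz
  rw [Complex.sub_re, Complex.ofReal_re, abs_le] at h
  nlinarith [h.1]

lemma abs_arg_le_of_norm_sub_le {x σ : ℝ} (hx : 0 < x) (hσ0 : 0 < σ) (hσ : σ < π / 2) {z : ℂ}
    (hz : ‖z - x‖ ≤ x * Real.sin σ) : |z.arg| ≤ σ := by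
  have hs0 : 0 < Real.sin σ := Real.sin_pos_of_pos_of_lt_pi hσ0 (by linarith [Real.pi_pos])
  have hs1 : Real.sin σ < 1 := by
    rw [← Real.sin_pi_div_two]
    exact Real.sin_lt_sin_of_lt_of_le_pi_div_two (by linarith) le_rfl hσ
  have hre := re_pos_of_norm_sub_le hx hs1 hz
  have hz0 : 0 < ‖z‖ := norm_pos_iff.2 fun h => by simp [h] at hre
  have hsq : (z.re - x) ^ 2 + z.im ^ 2 ≤ (x * Real.sin σ) ^ 2 := by
    have := pow_le_pow_left₀ (norm_nonneg _) hz 2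
    rw [Complex.sq_norm, Complex.normSq_apply] at this
    simp only [Complex.sub_re, Complex.ofReal_re, Complex.sub_im, Complex.ofReal_im] at this
    linarith
  have hnorm : ‖z‖ ^ 2 = z.re ^ 2 + z.im ^ 2 := by
    rw [Complex.sq_norm, Complex.normSq_apply]; ring
  have him : |z.im| ≤ Real.sin σ * ‖z‖ := by
    refine abs_le_of_sq_le_sq ?_ (by positivity)
    rw [mul_pow, hnorm]
    have hc : 0 ≤ 1 - Real.sin σ ^ 2 := by nlinarith
    nlinarith [sq_nonneg (z.re - (1 - Real.sin σ ^ 2) * x), mul_le_mul_of_nonneg_left hsq hc]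
  have hq : |z.im / ‖z‖| ≤ Real.sin σ := by
    rwa [abs_div, abs_of_pos hz0, div_le_iff₀ hz0]
  rw [Complex.arg_of_re_nonneg hre.le]
  rw [abs_le] at hq ⊢
  constructor
  · rw [Real.le_arcsin_iff_sin_le' ⟨by linarith, by linarith⟩, Real.sin_neg]
    exact hq.1
  · rw [Real.arcsin_le_iff_le_sin' ⟨by linarith, hσ⟩]
    exact hq.2

lemma norm_flamComplex_le {lam p : ℝ} (hlam : 0 ≤ lam) (hp : 0 ≤ p) {z : ℂ} (hz : z ≠ 0)
    (harg : p * |z.arg| ≤ π / 4) :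
    ‖flamComplex lam p z‖ ≤ Real.exp (-(lam * ‖z‖ ^ (-p))) := by
  have hn : 0 < ‖z‖ := norm_pos_iff.2 hz
  have hre : (z ^ (((-p : ℝ)) : ℂ)).re = ‖z‖ ^ (-p) * Real.cos (p * |z.arg|) := by
    rw [Complex.cpow_def_of_ne_zero hz, Complex.exp_re, Complex.re_mul_ofReal,
      Complex.im_mul_ofReal, Complex.log_re, Complex.log_im, Real.rpow_def_of_pos hn,
      ← Real.cos_abs (z.arg * -p), abs_mul, abs_neg, abs_of_nonneg hp, mul_comm p]
  have hcos : Real.sqrt 2 / 2 ≤ Real.cos (p * |z.arg|) := by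
    rw [← Real.cos_pi_div_four]
    exact Real.cos_le_cos_of_nonneg_of_le_pi (by positivity) (by linarith [Real.pi_pos]) harg
  rw [flamComplex, Complex.norm_exp, Complex.neg_re, Complex.re_ofReal_mul, hre]
  refine Real.exp_le_exp.2 (neg_le_neg ?_)
  have hA : 0 ≤ lam * ‖z‖ ^ (-p) := by positivity
  have h1 : 1 ≤ Real.sqrt 2 * Real.cos (p * |z.arg|) := by
    nlinarith [Real.sq_sqrt (show (0 : ℝ) ≤ 2 by norm_num), Real.sqrt_nonneg 2]
  nlinarith

lemma pow_mul_exp_neg_rpow_le {lam p u : ℝ} (hlam : 0 < lam) (hp : 0 < p) (hu : 0 < u) (k : ℕ) :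
    u ^ k * Real.exp (-(lam * u ^ p)) ≤
      (k.factorial : ℝ) ^ (1 / p) * ((lam * p) ^ (-(1 / p))) ^ k := by
  have hlp : 0 < lam * p := by positivity
  have hf : (0 : ℝ) < k.factorial := by positivity
  have hup : 0 < u ^ p := by positivity
  have key : (u ^ p) ^ k * Real.exp (-(lam * p * u ^ p)) ≤ k.factorial * (lam * p)⁻¹ ^ k := by
    have h := Real.pow_div_factorial_le_exp (lam * p * u ^ p) (by positivity) k
    rw [div_le_iff₀ hf, mul_pow] at h
    rw [Real.exp_neg, inv_pow, ← div_eq_mul_inv, ← div_eq_mul_inv,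
      div_le_div_iff₀ (Real.exp_pos _) (by positivity)]
    linarith
  have h2 := Real.rpow_le_rpow (by positivity) key (show 0 ≤ 1 / p by positivity)
  have e1 : ((u ^ p) ^ k * Real.exp (-(lam * p * u ^ p))) ^ (1 / p) =
      u ^ k * Real.exp (-(lam * u ^ p)) := by
    rw [Real.mul_rpow (by positivity) (by positivity), ← Real.exp_mul, ← Real.rpow_natCast,
      ← Real.rpow_mul hu.le, ← Real.rpow_mul hu.le, ← Real.rpow_natCast]
    congr 2 <;> field_simp
  have e2 : ((k.factorial : ℝ) * (lam * p)⁻¹ ^ k) ^ (1 / p) =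
      (k.factorial : ℝ) ^ (1 / p) * ((lam * p) ^ (-(1 / p))) ^ k := by
    rw [Real.mul_rpow (by positivity) (by positivity), Real.rpow_neg hlp.le,
      ← Real.inv_rpow hlp.le, ← Real.rpow_pow_comm (by positivity)]
  rwa [e1, e2] at h2

lemma abs_iteratedDeriv_flam_le {lam p σ : ℝ} (hlam : 0 < lam) (hp : 0 < p) (hσ0 : 0 < σ)
    (hσ : σ < π / 2) (hpσ : p * σ ≤ π / 4) (k : ℕ) (x : ℝ) :
    |iteratedDeriv k (flam lam p) x| ≤
      (k.factorial : ℝ) ^ (1 + 1 / p) * (2 / Real.sin σ * (lam * p) ^ (-(1 / p))) ^ k := by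
  have hs0 : 0 < Real.sin σ := Real.sin_pos_of_pos_of_lt_pi hσ0 (by linarith [Real.pi_pos])
  have hs1 : Real.sin σ < 1 := by
    rw [← Real.sin_pi_div_two]
    exact Real.sin_lt_sin_of_lt_of_le_pi_div_two (by linarith) le_rfl hσ
  rcases le_or_gt x 0 with hx | hx
  · rw [iteratedDeriv_flam_of_nonpos lam p k hx, abs_zero]
    positivity
  rw [iteratedDeriv_flam_of_pos lam p k hx]
  refine (Complex.abs_re_le_norm _).trans ?_
  have hr : 0 < x * Real.sin σ := by positivity
  have hbound : ∀ z ∈ Metric.sphere (x : ℂ) (x * Real.sin σ),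
      ‖flamComplex lam p z‖ ≤ Real.exp (-(lam * ((2 * x)⁻¹) ^ p)) := by
    intro z hz
    have hz' : ‖z - x‖ ≤ x * Real.sin σ := (mem_sphere_iff_norm.1 hz).le
    have hz0 : z ≠ 0 := fun h => by
      simpa [h] using re_pos_of_norm_sub_le hx hs1 hz'
    refine (norm_flamComplex_le hlam.le hp.le hz0 ((mul_le_mul_of_nonneg_left
      (abs_arg_le_of_norm_sub_le hx hσ0 hσ hz') hp.le).trans hpσ)).trans ?_
    have hn : ‖z‖ ≤ 2 * x := by
      have h := norm_add_le (z - x) (x : ℂ)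
      rw [sub_add_cancel, Complex.norm_real, Real.norm_of_nonneg hx.le] at h
      nlinarith
    rw [Real.rpow_neg (norm_nonneg _), ← Real.inv_rpow (norm_nonneg _)]
    have := norm_pos_iff.2 hz0
    gcongr
  have hdiff : DiffContOnCl ℂ (flamComplex lam p) (Metric.ball (x : ℂ) (x * Real.sin σ)) := by
    refine DifferentiableOn.diffContOnCl_ball (U := Metric.closedBall (x : ℂ) (x * Real.sin σ))
      (fun z hz => ?_) subset_rfl
    exact (differentiableAt_flamComplex lam p (re_pos_of_norm_sub_le hx hs1
      (mem_closedBall_iff_norm.1 hz))).differentiableWithinAt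
  refine (Complex.norm_iteratedDeriv_le_of_forall_mem_sphere_norm_le k hr hdiff hbound).trans ?_
  have hk := pow_mul_exp_neg_rpow_le hlam hp (show 0 < (2 * x)⁻¹ by positivity) k
  have hf : (0 : ℝ) < k.factorial := by positivity
  calc k.factorial * Real.exp (-(lam * ((2 * x)⁻¹) ^ p)) / (x * Real.sin σ) ^ k
      = k.factorial * (2 / Real.sin σ) ^ k *
          (((2 * x)⁻¹) ^ k * Real.exp (-(lam * ((2 * x)⁻¹) ^ p))) := by
        have : 2 / Real.sin σ * (2 * x)⁻¹ = (x * Real.sin σ)⁻¹ := by field_simp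
        rw [div_eq_mul_inv, ← inv_pow, ← this, mul_pow]
        ring
    _ ≤ k.factorial * (2 / Real.sin σ) ^ k *
          ((k.factorial : ℝ) ^ (1 / p) * ((lam * p) ^ (-(1 / p))) ^ k) := by gcongr
    _ = _ := by
        rw [Real.rpow_add hf, Real.rpow_one, mul_pow]
        ring

/-- with α > 1, p = 1/(α−1), σ = (π/4)·min{1,1/p}, L > 0 and
λ > (2L^α/sin σ)^p / p, the Gevrey-α series
∑_k (L^{kα}/(k!)^α) · sup_x |f_λ^{(k)}(x)| converges, i.e. f_λ is Gevrey-α. -/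
theorem stmt7 (α p σ L lam : ℝ) (hα : 1 < α) (hp : p = 1 / (α - 1))
    (hσ : σ = π / 4 * min 1 (1 / p)) (hL : 0 < L)
    (hlam : (2 * L ^ α / Real.sin σ) ^ p / p < lam) :
    Summable (fun k : ℕ =>
      L ^ ((k : ℝ) * α) / (Nat.factorial k : ℝ) ^ α *
        ⨆ x : ℝ, |iteratedDeriv k (flam lam p) x|) := by
  have hα1 : 0 < α - 1 := by linarith
  have hp0 : 0 < p := by rw [hp]; positivity
  have hαp : 1 + 1 / p = α := by rw [hp]; field_simp; ring
  have hσ0 : 0 < σ := by rw [hσ]; have := Real.pi_pos; positivity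
  have hσ4 : σ ≤ π / 4 := by
    rw [hσ]
    exact mul_le_of_le_one_right (by positivity) (min_le_left _ _)
  have hσ2 : σ < π / 2 := by linarith [Real.pi_pos]
  have hpσ : p * σ ≤ π / 4 := by
    have h : p * min 1 (1 / p) ≤ 1 := by
      calc p * min 1 (1 / p) ≤ p * (1 / p) := by gcongr; exact min_le_right _ _
        _ = 1 := by field_simp
    rw [hσ]
    nlinarith [Real.pi_pos]
  have hs0 : 0 < Real.sin σ := Real.sin_pos_of_pos_of_lt_pi hσ0 (by linarith [Real.pi_pos])
  have hlam0 : 0 < lam := lt_of_le_of_lt (by positivity) hlam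
  set q := L ^ α * (2 / Real.sin σ * (lam * p) ^ (-(1 / p))) with hq
  have hq0 : 0 ≤ q := by positivity
  have hq1 : q < 1 := by
    rw [div_lt_iff₀ hp0] at hlam
    have h := Real.rpow_lt_rpow (by positivity) hlam (show 0 < 1 / p by positivity)
    rw [← Real.rpow_mul (by positivity), mul_one_div_cancel hp0.ne', Real.rpow_one] at h
    have hpos : 0 < (lam * p) ^ (1 / p) := by positivity
    have : q = 2 * L ^ α / Real.sin σ / (lam * p) ^ (1 / p) := by
      rw [hq, Real.rpow_neg (by positivity)]
      ring
    rwa [this, div_lt_one hpos]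
  refine Summable.of_nonneg_of_le (fun k => ?_) (fun k => ?_) (summable_geometric_of_lt_one hq0 hq1)
  · exact mul_nonneg (by positivity) (Real.iSup_nonneg fun x => abs_nonneg _)
  · have hsup : (⨆ x : ℝ, |iteratedDeriv k (flam lam p) x|) ≤
        (k.factorial : ℝ) ^ α * (2 / Real.sin σ * (lam * p) ^ (-(1 / p))) ^ k := by
      rw [← hαp]
      exact ciSup_le fun x => abs_iteratedDeriv_flam_le hlam0 hp0 hσ0 hσ2 hpσ k x
    have hfα : (0 : ℝ) < (k.factorial : ℝ) ^ α := by positivity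
    calc _ ≤ L ^ ((k : ℝ) * α) / (k.factorial : ℝ) ^ α *
          ((k.factorial : ℝ) ^ α * (2 / Real.sin σ * (lam * p) ^ (-(1 / p))) ^ k) := by gcongr
      _ = q ^ k := by
        rw [← mul_assoc, div_mul_cancel₀ _ hfα.ne', mul_comm (k : ℝ) α,
          Real.rpow_mul_natCast hL.le, ← mul_pow]
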